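/- There exists a function L̃ : (0,1) → ℝ, slowly varying at 0⁺, such that for every r ∈ [0,1) one has ∑_{k=1}^∞ k·ρ(k)·r^{k−1} = 1 − α·(1−r)^{α−1}·L̃(1−r), and moreover L̃(x)/L(x) → 1 as x → 0⁺. -/

import Mathlib

open scoped BigOperators

lemma tangent_pow (a b : ℝ) (ha : 0 ≤ a) (hb : 0 ≤ b) (k : ℕ) :
    a ^ k + k * a ^ (k - 1) * (b - a) ≤ b ^ k := by
  rcases k with _ | k
  · simp
  · induction k with
    | zero => simp
    | succ k ih =>
      have h1 := mul_le_mul_of_nonneg_left ih hb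
      have h2 : 0 ≤ ((k : ℝ) + 1) * a ^ k * (b - a) ^ 2 := by positivity
      simp only [Nat.add_sub_cancel] at h1 ⊢
      push_cast at h1 ⊢
      have e : b ^ (k + 1 + 1) = b * b ^ (k + 1) := by ring
      rw [e]
      refine le_trans (le_of_sub_nonneg (le_of_le_of_eq h2 ?_)) h1
      ring

lemma tangent_sum (ρ : ℕ → ℝ) (hρ0 : ∀ k, 0 ≤ ρ k) (h0 : Summable ρ)
    (h1 : Summable fun k : ℕ => (k : ℝ) * ρ k) (a b : ℝ) (ha : 0 ≤ a) (ha1 : a ≤ 1)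
    (hb : 0 ≤ b) (hb1 : b ≤ 1) :
    (∑' k : ℕ, ρ k * a ^ k) + (∑' k : ℕ, (k : ℝ) * ρ k * a ^ (k - 1)) * (b - a)
      ≤ ∑' k : ℕ, ρ k * b ^ k := by
  have s (c : ℝ) (hc : 0 ≤ c) (hc1 : c ≤ 1) : Summable fun k : ℕ => ρ k * c ^ k :=
    Summable.of_nonneg_of_le (fun k => mul_nonneg (hρ0 k) (pow_nonneg hc k))
      (fun k => mul_le_of_le_one_right (hρ0 k) (pow_le_one₀ hc hc1)) h0
  have s' : Summable fun k : ℕ => (k : ℝ) * ρ k * a ^ (k - 1) :=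
    Summable.of_nonneg_of_le
      (fun k => mul_nonneg (mul_nonneg k.cast_nonneg (hρ0 k)) (pow_nonneg ha _))
      (fun k => mul_le_of_le_one_right (mul_nonneg k.cast_nonneg (hρ0 k))
        (pow_le_one₀ ha ha1)) h1
  rw [← tsum_mul_right, ← (s a ha ha1).tsum_add (s'.mul_right _)]
  refine Summable.tsum_le_tsum (fun k => ?_) ((s a ha ha1).add (s'.mul_right _)) (s b hb hb1)
  have := mul_le_mul_of_nonneg_left (tangent_pow a b ha hb k) (hρ0 k)
  linarith

/-- Given a critical offspring distribution `ρ` in the domain of attraction of a stable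
law of index `α ∈ (1,2]`, i.e. `∑_k ρ(k) r^k = r + (1−r)^α L(1−r)` with `L` slowly
varying at `0⁺`, there is a slowly varying `L̃` with
`∑_{k≥1} k ρ(k) r^{k−1} = 1 − α (1−r)^{α−1} L̃(1−r)` and `L̃(x)/L(x) → 1` as `x → 0⁺`. -/
theorem stmt_14 (ρ : ℕ → ℝ) (hρ0 : ∀ k, 0 ≤ ρ k) (hρsum : ∑' k : ℕ, ρ k = 1)
    (hmean : ∑' k : ℕ, (k : ℝ) * ρ k = 1) (hρ1 : ρ 1 ≠ 1)
    (α : ℝ) (hα1 : 1 < α) (hα2 : α ≤ 2) (L : ℝ → ℝ)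
    (hL : ∀ x ∈ Set.Ioo (0 : ℝ) 1,
      L x = ((∑' k : ℕ, ρ k * (1 - x) ^ k) - (1 - x)) / x ^ α)
    (hslow : ∀ c : ℝ, 0 < c →
      Filter.Tendsto (fun x : ℝ => L (c * x) / L x) (nhdsWithin 0 (Set.Ioi 0)) (nhds 1)) :
    ∃ Ltilde : ℝ → ℝ,
      (∀ c : ℝ, 0 < c →
        Filter.Tendsto (fun x : ℝ => Ltilde (c * x) / Ltilde x)
          (nhdsWithin 0 (Set.Ioi 0)) (nhds 1)) ∧
      (∀ r ∈ Set.Ico (0 : ℝ) 1,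
        ∑' k : ℕ, (k : ℝ) * ρ k * r ^ (k - 1) = 1 - α * (1 - r) ^ (α - 1) * Ltilde (1 - r)) ∧
      Filter.Tendsto (fun x : ℝ => Ltilde x / L x) (nhdsWithin 0 (Set.Ioi 0)) (nhds 1) := by
  have h0 : Summable ρ := by
    by_contra h
    rw [tsum_eq_zero_of_not_summable h] at hρsum
    norm_num at hρsum
  have h1 : Summable fun k : ℕ => (k : ℝ) * ρ k := by
    by_contra h
    rw [tsum_eq_zero_of_not_summable h] at hmean
    norm_num at hmean
  have hα0 : 0 < α := by linarith
  set l := nhdsWithin (0 : ℝ) (Set.Ioi 0) with hl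
  have hpos : ∀ᶠ x in l, 0 < x := self_mem_nhdsWithin
  have hscale : ∀ c : ℝ, 0 < c → Filter.Tendsto (fun x : ℝ => c * x) l l := by
    intro c hc
    refine tendsto_nhdsWithin_iff.2 ⟨?_, ?_⟩
    · have : Filter.Tendsto (fun x : ℝ => c * x) (nhds 0) (nhds (c * 0)) :=
        (continuous_const.mul continuous_id).tendsto 0
      rw [mul_zero] at this
      exact this.mono_left nhdsWithin_le_nhds
    · filter_upwards [hpos] with x hx
      exact mul_pos hc hx
  have hlt : ∀ᶠ x in l, x < 1 :=
    nhdsWithin_le_nhds (eventually_lt_nhds (by norm_num : (0 : ℝ) < 1))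
  have hne : ∀ᶠ x in l, L x ≠ 0 := by
    filter_upwards [(hslow 1 one_pos).eventually (lt_mem_nhds (by norm_num : (0 : ℝ) < 1))]
      with x hx h
    simp [h] at hx
  have hF : ∀ x, 0 < x → x < 1 → x ^ α * L x = (∑' k : ℕ, ρ k * (1 - x) ^ k) - (1 - x) := by
    intro x hx hx1
    rw [hL x ⟨hx, hx1⟩]
    have := (Real.rpow_pos_of_pos hx α).ne'
    field_simp
  have hLpos : ∀ᶠ x in l, 0 < L x := by
    filter_upwards [hpos, hlt, hne] with x hx hx1 hn
    refine lt_of_le_of_ne ?_ hn.symm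
    have ht := tangent_sum ρ hρ0 h0 h1 1 (1 - x) (by norm_num) le_rfl (by linarith) (by linarith)
    simp only [one_pow, mul_one, hρsum, hmean] at ht
    have h2 := hF x hx hx1
    have h3 := Real.rpow_pos_of_pos hx α
    by_contra hc
    push Not at hc
    nlinarith [mul_neg_of_pos_of_neg h3 (lt_of_le_of_ne hc.le hn)]
  set D : ℝ → ℝ := fun x => 1 - ∑' k : ℕ, (k : ℝ) * ρ k * (1 - x) ^ (k - 1) with hD
  set T : ℝ → ℝ := fun x => D x / (α * x ^ (α - 1)) with hT
  have key : ∀ c : ℝ, 0 < c → ∀ᶠ x in l,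
      α * (T x / L x) * (c - 1) ≤ c ^ α * (L (c * x) / L x) - 1 := by
    intro c hc
    filter_upwards [hpos, hlt, hLpos, (hscale c hc).eventually hlt] with x hx hx1 hLx hcx1
    have hcx : 0 < c * x := mul_pos hc hx
    have ht := tangent_sum ρ hρ0 h0 h1 (1 - x) (1 - c * x) (by linarith) (by linarith)
      (by linarith) (by linarith)
    have h2 := hF x hx hx1
    have h3 := hF (c * x) hcx hcx1
    have hxa := Real.rpow_pos_of_pos hx α
    have hxb := Real.rpow_pos_of_pos hx (α - 1)
    have hm : D x * ((c - 1) * x) ≤ (c * x) ^ α * L (c * x) - x ^ α * L x := by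
      rw [h2, h3]
      simp only [hD]
      linarith
    rw [Real.mul_rpow hc.le hx.le] at hm
    have hxx : x ^ α = x ^ (α - 1) * x := by
      rw [← Real.rpow_add_one hx.ne']
      ring_nf
    refine le_of_mul_le_mul_right ?_ (mul_pos hxa hLx)
    have e1 : α * (T x / L x) * (c - 1) * (x ^ α * L x) = D x * ((c - 1) * x) := by
      simp only [hT]
      rw [hxx]
      field_simp
    have e2 : (c ^ α * (L (c * x) / L x) - 1) * (x ^ α * L x)
        = c ^ α * x ^ α * L (c * x) - x ^ α * L x := by
      field_simp
    rw [e1, e2]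
    exact hm
  have hder : Filter.Tendsto (fun c : ℝ => (c ^ α - 1) / (c - 1) / α)
      (nhdsWithin 1 {1}ᶜ) (nhds 1) := by
    have h := (Real.hasDerivAt_rpow_const (x := 1) (p := α) (Or.inl one_ne_zero))
    rw [hasDerivAt_iff_tendsto_slope] at h
    have h' := h.div_const α
    simp only [Real.one_rpow, mul_one, div_self hα0.ne'] at h'
    refine h'.congr (fun c => ?_)
    simp [slope_def_field]
  have hlim : ∀ c : ℝ, 0 < c → Filter.Tendsto
      (fun x => (c ^ α * (L (c * x) / L x) - 1) / (c - 1) / α) l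
      (nhds ((c ^ α - 1) / (c - 1) / α)) := by
    intro c hc
    have := ((((hslow c hc).const_mul (c ^ α)).sub_const 1).div_const (c - 1)).div_const α
    simpa using this
  have main : Filter.Tendsto (fun x : ℝ => T x / L x) l (nhds 1) := by
    rw [tendsto_order]
    constructor
    · intro a ha
      have hd : Filter.Tendsto (fun c : ℝ => (c ^ α - 1) / (c - 1) / α)
          (nhdsWithin 1 (Set.Iio 1)) (nhds 1) :=
        hder.mono_left (nhdsWithin_mono _ (fun c hc => ne_of_lt hc))
      have hp : ∀ᶠ c : ℝ in nhdsWithin 1 (Set.Iio 1), 0 < c :=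
        nhdsWithin_le_nhds (lt_mem_nhds one_pos)
      obtain ⟨c, hca, hc1, hc0⟩ := ((hd.eventually (lt_mem_nhds ha)).and
        ((eventually_mem_nhdsWithin (a := (1 : ℝ)) (s := Set.Iio 1)).and hp)).exists
      filter_upwards [(hlim c hc0).eventually (lt_mem_nhds hca), key c hc0] with x hx hk
      refine lt_of_lt_of_le hx ?_
      have hc1' : c - 1 < 0 := sub_neg.2 hc1
      rw [div_le_iff₀ hα0, div_le_iff_of_neg hc1']
      linarith
    · intro a ha
      have hd : Filter.Tendsto (fun c : ℝ => (c ^ α - 1) / (c - 1) / α)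
          (nhdsWithin 1 (Set.Ioi 1)) (nhds 1) :=
        hder.mono_left (nhdsWithin_mono _ (fun c hc => ne_of_gt hc))
      obtain ⟨c, hca, hc1⟩ := ((hd.eventually (gt_mem_nhds ha)).and
        (self_mem_nhdsWithin : Set.Ioi (1 : ℝ) ∈ nhdsWithin 1 (Set.Ioi 1))).exists
      have hc1' : 0 < c - 1 := sub_pos.2 hc1
      have hc0 : 0 < c := by linarith
      filter_upwards [(hlim c hc0).eventually (gt_mem_nhds hca), key c hc0] with x hx hk
      refine lt_of_le_of_lt ?_ hx
      rw [le_div_iff₀ hα0, le_div_iff₀ hc1']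
      linarith
  refine ⟨T, ?_, ?_, main⟩
  · intro c hc
    have h := ((main.comp (hscale c hc)).mul (hslow c hc)).div main one_ne_zero
    simp only [mul_one, div_one] at h
    refine h.congr' ?_
    filter_upwards [hne, (hscale c hc).eventually hne] with x hx hcx
    simp only [Function.comp, Pi.div_apply]
    rw [div_mul_div_cancel₀ hcx, div_div_div_cancel_right₀ hx]
  · intro r hr
    have hx : 0 < 1 - r := sub_pos.2 hr.2
    have hxb := Real.rpow_pos_of_pos hx (α - 1)
    have e : α * (1 - r) ^ (α - 1) * T (1 - r) = D (1 - r) := by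
      simp only [hT]
      field_simp
    rw [e]
    simp [hD]
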